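/- arXiv:1410.8650 — 5 statements merged into one kernel-verified Lean document; each statement's English description precedes it below -/
import Mathlib

section
/- Let Ω ⊆ ℝ^N be an open set and let Φ : Ω → ℝ^N be a C^∞ map such that for every C^∞ function f : ℝ^N → ℝ one has Δ(f ∘ Φ)(y) = (Δf)(Φ(y)) for all y ∈ Ω. Then for every y ∈ Ω the Jacobian matrix DΦ(y) = (∂Φ_i/∂y_j(y))_{i,j=1}^N is an orthogonal matrix; equivalently, the gradients satisfy ⟨∇Φ_i(y), ∇Φ_j(y)⟩ = δ_{ij} for all 1 ≤ i, j ≤ N and y ∈ Ω. -/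
/-- The Euclidean Laplacian `Δg(y) = Σ_i ∂²g/∂y_i²(y)` of a function on `ℝ^N`,
expressed via iterated Fréchet derivatives in the coordinate directions. -/
noncomputable def laplacianAt {N : ℕ} {E : Type*} [NormedAddCommGroup E] [NormedSpace ℝ E]
    (g : (Fin N → ℝ) → E) (y : Fin N → ℝ) : E :=
  ∑ i : Fin N, fderiv ℝ (fun z => fderiv ℝ g z (Pi.single i 1)) y (Pi.single i 1)

open scoped Topology

theorem laplacianAt_mul {N : ℕ} {u v : (Fin N → ℝ) → ℝ} {y : Fin N → ℝ}
    (hu : ContDiffAt ℝ 2 u y) (hv : ContDiffAt ℝ 2 v y) :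
    laplacianAt (fun z => u z * v z) y =
      u y * laplacianAt v y + v y * laplacianAt u y +
        2 * ∑ k : Fin N, fderiv ℝ u y (Pi.single k 1) * fderiv ℝ v y (Pi.single k 1) := by
  have hdiff : ∀ {g : (Fin N → ℝ) → ℝ}, ContDiffAt ℝ 2 g y →
      ∀ e, DifferentiableAt ℝ (fun z => fderiv ℝ g z e) y := fun hg e =>
    ((hg.fderiv_right (m := 1) (by norm_num)).differentiableAt (by norm_num)).clm_apply
      (differentiableAt_const e)
  have hev : ∀ {g : (Fin N → ℝ) → ℝ}, ContDiffAt ℝ 2 g y →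
      ∀ᶠ z in 𝓝 y, DifferentiableAt ℝ g z := fun hg =>
    (hg.eventually (by simp)).mono fun z hz => hz.differentiableAt (by norm_num)
  have hu1 : DifferentiableAt ℝ u y := hu.differentiableAt (by norm_num)
  have hv1 : DifferentiableAt ℝ v y := hv.differentiableAt (by norm_num)
  unfold laplacianAt
  rw [Finset.mul_sum, Finset.mul_sum, Finset.mul_sum, ← Finset.sum_add_distrib,
    ← Finset.sum_add_distrib]
  refine Finset.sum_congr rfl fun k _ => ?_
  have hfirst : (fun z => fderiv ℝ (fun z => u z * v z) z (Pi.single k 1)) =ᶠ[𝓝 y]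
      fun z => u z * fderiv ℝ v z (Pi.single k 1) + v z * fderiv ℝ u z (Pi.single k 1) := by
    filter_upwards [hev hu, hev hv] with z hz hz'
    rw [fderiv_fun_mul hz hz']
    simp
  rw [hfirst.fderiv_eq,
    fderiv_fun_add (hu1.fun_mul (hdiff hv _)) (hv1.fun_mul (hdiff hu _)),
    fderiv_fun_mul hu1 (hdiff hv _), fderiv_fun_mul hv1 (hdiff hu _)]
  simp only [add_apply, smul_apply, smul_eq_mul]
  ring

theorem fderiv_coord {N : ℕ} (i : Fin N) (y e : Fin N → ℝ) :
    fderiv ℝ (fun z : Fin N → ℝ => z i) y e = e i := by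
  rw [(hasFDerivAt_apply i y).fderiv]
  rfl

theorem laplacianAt_coord {N : ℕ} (i : Fin N) (y : Fin N → ℝ) :
    laplacianAt (fun z : Fin N → ℝ => z i) y = 0 := by
  simp [laplacianAt, fderiv_coord]

/-- If `Φ : Ω → ℝ^N` is `C^∞` and `Δ(f ∘ Φ) = (Δf) ∘ Φ` on `Ω` for every
`C^∞` function `f : ℝ^N → ℝ`, then at every point of `Ω` the Jacobian matrix of `Φ` is
orthogonal; equivalently `⟨∇Φ_i(y), ∇Φ_j(y)⟩ = δ_{ij}` for all `i, j` and all `y ∈ Ω`. -/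
theorem jacobian_orthogonal
    {N : ℕ} (Ω : Set (Fin N → ℝ)) (hΩ : IsOpen Ω)
    (Φ : (Fin N → ℝ) → (Fin N → ℝ)) (hΦ : ContDiffOn ℝ (⊤ : ℕ∞) Φ Ω)
    (hcomm : ∀ f : (Fin N → ℝ) → ℝ, ContDiff ℝ (⊤ : ℕ∞) f →
      ∀ y ∈ Ω, laplacianAt (fun z => f (Φ z)) y = laplacianAt f (Φ y)) :
    ∀ y ∈ Ω, ∀ i j : Fin N,
      ∑ k : Fin N, (fderiv ℝ (fun z => Φ z i) y (Pi.single k 1)) *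
          (fderiv ℝ (fun z => Φ z j) y (Pi.single k 1)) =
        (if i = j then (1 : ℝ) else 0) := by
  intro y hy i j
  have hcoord : ∀ i : Fin N, ContDiff ℝ (⊤ : ℕ∞) fun x : Fin N → ℝ => x i := fun i =>
    contDiff_apply ℝ ℝ i
  have hΦy : ∀ i, ContDiffAt ℝ 2 (fun z => Φ z i) y := fun i =>
    ((contDiffAt_pi.1 (hΦ.contDiffAt (hΩ.mem_nhds hy))) i).of_le
      (WithTop.coe_le_coe.2 (le_top : (2 : ℕ∞) ≤ ⊤))
  have hharm : ∀ i, laplacianAt (fun z => Φ z i) y = 0 := fun i =>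
    (hcomm (fun x => x i) (hcoord i) y hy).trans (laplacianAt_coord i _)
  have h := hcomm (fun x => x i * x j) ((hcoord i).mul (hcoord j)) y hy
  rw [laplacianAt_mul (hΦy i) (hΦy j),
    laplacianAt_mul (contDiff_apply ℝ ℝ i).contDiffAt (contDiff_apply ℝ ℝ j).contDiffAt,
    hharm, hharm, laplacianAt_coord, laplacianAt_coord] at h
  simp only [fderiv_coord, mul_zero, zero_add] at h
  rw [mul_left_cancel₀ two_ne_zero h]
  simp [Pi.single_apply]
end

section
/- Let Ω ⊆ ℝ^N be open and connected and let D : Ω → M_n(ℂ) be a map such that each entry D_{ij} : Ω → ℂ is harmonic on Ω and such that D(y) is a unitary matrix for every y ∈ Ω. Then D is constant on Ω. -/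
/-- `g` is harmonic on `Ω`: it is `C²` on `Ω` and its Laplacian vanishes on `Ω`. -/
def IsHarmonicOn {N : ℕ} {E : Type*} [NormedAddCommGroup E] [NormedSpace ℝ E]
    (g : (Fin N → ℝ) → E) (Ω : Set (Fin N → ℝ)) : Prop :=
  ContDiffOn ℝ 2 g Ω ∧ ∀ y ∈ Ω, laplacianAt g y = 0

/-- If the sum of the squared norms of finitely many `C²` functions is constant on an open set,
then its second derivative in the direction `e`, computed by the product rule, vanishes. -/
theorem sum_inner_fderiv_fderiv_add_norm_sq_eq_zero {V E ι : Type*} [NormedAddCommGroup V]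
    [NormedSpace ℝ V] [NormedAddCommGroup E] [InnerProductSpace ℝ E] [Fintype ι] {Ω : Set V}
    (hΩ : IsOpen Ω) {g : ι → V → E} (hg : ∀ k, ContDiffOn ℝ 2 (g k) Ω) {c : ℝ}
    (hc : ∀ y ∈ Ω, ∑ k, ‖g k y‖ ^ 2 = c) {y : V} (hy : y ∈ Ω) (e : V) :
    ∑ k, (inner ℝ (g k y) (fderiv ℝ (fun z => fderiv ℝ (g k) z e) y e) +
      ‖fderiv ℝ (g k) y e‖ ^ 2) = 0 := by
  have hdiff : ∀ k, ∀ z ∈ Ω, DifferentiableAt ℝ (g k) z := fun k z hz =>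
    ((hg k).contDiffAt (hΩ.mem_nhds hz)).differentiableAt (by norm_num)
  have hdiff' : ∀ k, DifferentiableAt ℝ (fun z => fderiv ℝ (g k) z e) y := fun k =>
    (((((hg k).contDiffAt (hΩ.mem_nhds hy)).fderiv_right (m := 1) (by norm_num)
      ).differentiableAt (by norm_num)).clm_apply (differentiableAt_const e))
  have hfirst : ∀ z ∈ Ω, ∑ k, inner ℝ (g k z) (fderiv ℝ (g k) z e) = 0 := by
    intro z hz
    have hderiv := HasFDerivAt.fun_sum (u := Finset.univ)
      fun k _ => (hdiff k z hz).hasFDerivAt.norm_sq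
    have hconst : (fun z => ∑ k, ‖g k z‖ ^ 2) =ᶠ[nhds z] fun _ => c :=
      Filter.eventuallyEq_of_mem (hΩ.mem_nhds hz) hc
    have h := congrArg (fun L : V →L[ℝ] ℝ => L e)
      (hderiv.unique ((hasFDerivAt_const c z).congr_of_eventuallyEq hconst))
    simpa [sum_apply, ← Finset.mul_sum] using h
  have hderiv := HasFDerivAt.fun_sum (u := Finset.univ)
    fun k _ => (hdiff k y hy).hasFDerivAt.inner ℝ (hdiff' k).hasFDerivAt
  have hzero : (fun z => ∑ k, inner ℝ (g k z) (fderiv ℝ (g k) z e)) =ᶠ[nhds y] fun _ => (0 : ℝ) :=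
    Filter.eventuallyEq_of_mem (hΩ.mem_nhds hy) hfirst
  have h := congrArg (fun L : V →L[ℝ] ℝ => L e)
    (hderiv.unique ((hasFDerivAt_const 0 y).congr_of_eventuallyEq hzero))
  simpa [sum_apply] using h

/-- Harmonic functions whose squared norms add up to a constant have zero derivative. -/
theorem IsHarmonicOn.fderiv_eq_zero_of_sum_norm_sq_eq {N : ℕ} {E ι : Type*}
    [NormedAddCommGroup E] [InnerProductSpace ℝ E] [Fintype ι] {Ω : Set (Fin N → ℝ)}
    (hΩ : IsOpen Ω) {g : ι → (Fin N → ℝ) → E} (hg : ∀ k, IsHarmonicOn (g k) Ω) {c : ℝ}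
    (hc : ∀ y ∈ Ω, ∑ k, ‖g k y‖ ^ 2 = c) (k : ι) {y : Fin N → ℝ} (hy : y ∈ Ω) :
    fderiv ℝ (g k) y = 0 := by
  have hsum : ∑ k, ∑ i : Fin N, ‖fderiv ℝ (g k) y (Pi.single i 1)‖ ^ 2 = 0 := by
    have h := Finset.sum_eq_zero fun (i : Fin N) (_ : i ∈ Finset.univ) =>
      sum_inner_fderiv_fderiv_add_norm_sq_eq_zero hΩ (fun k => (hg k).1) hc hy (Pi.single i 1)
    rw [Finset.sum_comm] at h
    simp_rw [Finset.sum_add_distrib, ← inner_sum] at h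
    have hlap : ∀ k, inner ℝ (g k y) (∑ i : Fin N,
        fderiv ℝ (fun z => fderiv ℝ (g k) z (Pi.single i 1)) y (Pi.single i 1)) = 0 := fun k =>
      (congrArg (inner ℝ (g k y)) ((hg k).2 y hy)).trans (inner_zero_right _)
    simpa [hlap] using h
  rw [Finset.sum_eq_zero_iff_of_nonneg fun _ _ => by positivity] at hsum
  have hk := hsum k (Finset.mem_univ k)
  rw [Finset.sum_eq_zero_iff_of_nonneg fun _ _ => by positivity] at hk
  refine ContinuousLinearMap.coe_injective (LinearMap.pi_ext' fun i => ?_)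
  ext
  simpa using hk i (Finset.mem_univ i)

/-- The squared moduli of the entries of a unitary matrix add up to its size. -/
theorem Matrix.sum_norm_sq_of_mem_unitaryGroup {n : ℕ} {U : Matrix (Fin n) (Fin n) ℂ}
    (hU : U ∈ Matrix.unitaryGroup (Fin n) ℂ) :
    ∑ p : Fin n × Fin n, ‖U p.1 p.2‖ ^ 2 = n := by
  have h := congrArg Matrix.trace (Matrix.mem_unitaryGroup_iff.mp hU)
  simp only [Matrix.trace, Matrix.diag, Matrix.mul_apply, Matrix.star_apply, Matrix.one_apply_eq,
    RCLike.star_def, Complex.mul_conj'] at h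
  rw [Fintype.sum_prod_type]
  have h' : ((∑ i, ∑ j, ‖U i j‖ ^ 2 : ℝ) : ℂ) = ((n : ℝ) : ℂ) := by
    push_cast
    simpa using h
  exact_mod_cast h'

/-- If `D : Ω → M_n(ℂ)` has harmonic entries on the open connected set `Ω`
and `D(y)` is unitary for every `y ∈ Ω`, then `D` is constant on `Ω`. -/
theorem unitary_matrix_valued_harmonic_constant
    {N n : ℕ} (Ω : Set (Fin N → ℝ)) (hΩo : IsOpen Ω) (hΩc : IsConnected Ω)
    (D : (Fin N → ℝ) → Matrix (Fin n) (Fin n) ℂ)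
    (hharm : ∀ i j : Fin n, IsHarmonicOn (fun y => D y i j) Ω)
    (hunit : ∀ y ∈ Ω, D y ∈ Matrix.unitaryGroup (Fin n) ℂ) :
    ∀ y ∈ Ω, ∀ y' ∈ Ω, D y = D y' := by
  intro y hy y' hy'
  ext i j
  exact hΩo.is_const_of_fderiv_eq_zero hΩc.isPreconnected
    (fun z hz => (((hharm i j).1.contDiffAt (hΩo.mem_nhds hz)).differentiableAt
      (by norm_num)).differentiableWithinAt)
    (fun z hz => IsHarmonicOn.fderiv_eq_zero_of_sum_norm_sq_eq hΩo
      (g := fun (p : Fin n × Fin n) z => D z p.1 p.2) (fun p => hharm p.1 p.2)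
      (fun w hw => Matrix.sum_norm_sq_of_mem_unitaryGroup (hunit w hw)) (i, j) hz)
    hy hy'
end

section
/- Let A be a unital C*-algebra, let Ω ⊆ ℝ^N be open and connected, and let G : Ω → M_n(A) be a map such that each entry G_{ij} : Ω → A is harmonic on Ω and such that G(y) is a unitary element of the C*-algebra M_n(A) for every y ∈ Ω. Then G is constant on Ω. -/
open Topology in
/-- Second directional derivative of `star f * f`. -/
theorem fderiv_fderiv_star_mul_self {E A : Type*} [NormedAddCommGroup E] [NormedSpace ℝ E]
    [NormedRing A] [NormedAlgebra ℝ A] [StarRing A] [ContinuousStar A] [StarModule ℝ A]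
    {f : E → A} {y : E} (hf : ContDiffAt ℝ 2 f y) (v : E) :
    fderiv ℝ (fun z => fderiv ℝ (fun w => star (f w) * f w) z v) y v =
      star (fderiv ℝ (fun z => fderiv ℝ f z v) y v) * f y +
        star (f y) * fderiv ℝ (fun z => fderiv ℝ f z v) y v +
        2 • (star (fderiv ℝ f y v) * fderiv ℝ f y v) := by
  have key {g h : E → A} {z : E} (hg : DifferentiableAt ℝ g z) (hh : DifferentiableAt ℝ h z) :
      HasFDerivAt (fun w => star (g w) * h w) _ z := hg.hasFDerivAt.star.mul' hh.hasFDerivAt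
  have h₁ : ∀ᶠ z in 𝓝 y, fderiv ℝ (fun w => star (f w) * f w) z v =
      star (f z) * fderiv ℝ f z v + star (fderiv ℝ f z v) * f z := by
    filter_upwards [hf.eventually (by simp)] with z hz
    have hd := hz.differentiableAt (by norm_num)
    simp [(key hd hd).fderiv]
  have hd : DifferentiableAt ℝ f y := hf.differentiableAt (by norm_num)
  have hd' : DifferentiableAt ℝ (fun z => fderiv ℝ f z v) y :=
    ((hf.fderiv_right (m := 1) (by norm_num)).differentiableAt (by norm_num)).clm_apply
      (differentiableAt_const v)
  rw [Filter.EventuallyEq.fderiv_eq h₁, ((key hd hd').fun_add (key hd' hd)).fderiv]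
  simp [two_mul]
  abel

/-- In a C⋆-algebra, a vanishing finite sum of elements `star a * a` has vanishing terms. -/
theorem eq_zero_of_sum_star_mul_self_eq_zero {ι A : Type*} [NonUnitalCStarAlgebra A]
    {s : Finset ι} {a : ι → A} (h : ∑ i ∈ s, star (a i) * a i = 0) {i : ι} (hi : i ∈ s) :
    a i = 0 := by
  let : PartialOrder A := CStarAlgebra.spectralOrder A
  have : StarOrderedRing A := CStarAlgebra.spectralOrderedRing A
  exact CStarRing.star_mul_self_eq_zero_iff _ |>.mp <|
    (Finset.sum_eq_zero_iff_of_nonneg fun j _ => star_mul_self_nonneg (a j)).mp h i hi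

/-- Finitely many harmonic functions `f k` with `∑ k, star (f k) * f k` constant on an open set
have vanishing derivative there. -/
theorem fderiv_eq_zero_of_sum_star_mul_self_eq {N : ℕ} {ι A : Type*} [Fintype ι] [CStarAlgebra A]
    {Ω : Set (Fin N → ℝ)} (hΩ : IsOpen Ω) {f : ι → (Fin N → ℝ) → A}
    (hf : ∀ k, IsHarmonicOn (f k) Ω) {c : A} (hc : ∀ y ∈ Ω, ∑ k, star (f k y) * f k y = c)
    {y : Fin N → ℝ} (hy : y ∈ Ω) (k : ι) : fderiv ℝ (f k) y = 0 := by
  have hC {z} (hz : z ∈ Ω) (k : ι) : ContDiffAt ℝ 2 (f k) z :=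
    (hf k).1.contDiffAt (hΩ.mem_nhds hz)
  have hCs {z} (hz : z ∈ Ω) (k : ι) : ContDiffAt ℝ 2 (fun w => star (f k w) * f k w) z :=
    ((starL' ℝ : A ≃L[ℝ] A).contDiff.contDiffAt.comp z (hC hz k)).mul (hC hz k)
  have hdir (v : Fin N → ℝ) :
      ∑ k, fderiv ℝ (fun z => fderiv ℝ (fun w => star (f k w) * f k w) z v) y v = 0 := by
    have hloc : (fun z => ∑ k, fderiv ℝ (fun w => star (f k w) * f k w) z v)
        =ᶠ[nhds y] fun _ => 0 := by
      filter_upwards [hΩ.mem_nhds hy] with z hz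
      have hconst : (fun w => ∑ k, star (f k w) * f k w) =ᶠ[nhds z] fun _ => c :=
        Filter.eventually_of_mem (hΩ.mem_nhds hz) hc
      have := hconst.fderiv_eq (𝕜 := ℝ)
      rw [fderiv_fun_sum fun k _ => (hCs hz k).differentiableAt (by norm_num)] at this
      simpa using DFunLike.congr_fun this v
    have := hloc.fderiv_eq (𝕜 := ℝ)
    rw [fderiv_fun_sum fun k _ =>
      (((hCs hy k).fderiv_right (m := 1) (by norm_num)).differentiableAt (by norm_num)).clm_apply
        (differentiableAt_const v)] at this
    simpa using DFunLike.congr_fun this v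
  have hlap (k : ι) : ∑ l : Fin N, fderiv ℝ (fun z => fderiv ℝ (fun w => star (f k w) * f k w) z
      (Pi.single l 1)) y (Pi.single l 1) = 2 • ∑ l : Fin N,
        star (fderiv ℝ (f k) y (Pi.single l 1)) * fderiv ℝ (f k) y (Pi.single l 1) := by
    have h0 := (hf k).2 y hy
    rw [laplacianAt] at h0
    simp_rw [fderiv_fderiv_star_mul_self (hC hy k), Finset.sum_add_distrib, ← Finset.sum_mul,
      ← Finset.mul_sum, ← star_sum, h0, ← Finset.smul_sum]
    simp
  have hsum : ∑ p : ι × Fin N, star (fderiv ℝ (f p.1) y (Pi.single p.2 1)) *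
      fderiv ℝ (f p.1) y (Pi.single p.2 1) = 0 := by
    have h2 : (2 : ℝ) • ∑ p : ι × Fin N, star (fderiv ℝ (f p.1) y (Pi.single p.2 1)) *
        fderiv ℝ (f p.1) y (Pi.single p.2 1) = 0 := by
      rw [Fintype.sum_prod_type, ofNat_smul_eq_nsmul, Finset.smul_sum]
      simp_rw [← hlap]
      rw [Finset.sum_comm]
      exact Finset.sum_eq_zero fun l _ => hdir _
    exact (smul_eq_zero.mp h2).resolve_left two_ne_zero
  refine ContinuousLinearMap.coe_injective <| LinearMap.pi_ext' fun l => LinearMap.ext_ring ?_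
  simpa using eq_zero_of_sum_star_mul_self_eq_zero hsum (Finset.mem_univ (k, l))

/-- Let `A` be a unital C*-algebra. If `G : Ω → M_n(A)` has harmonic
entries on the open connected set `Ω` and `G(y)` is a unitary element of `M_n(A)` for
every `y ∈ Ω`, then `G` is constant on `Ω`. -/
theorem unitary_cstar_matrix_valued_harmonic_constant
    {N n : ℕ} {A : Type*} [NormedRing A] [StarRing A] [CStarRing A]
    [NormedAlgebra ℂ A] [StarModule ℂ A] [CompleteSpace A]
    (Ω : Set (Fin N → ℝ)) (hΩo : IsOpen Ω) (hΩc : IsConnected Ω)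
    (G : (Fin N → ℝ) → Matrix (Fin n) (Fin n) A)
    (hharm : ∀ i j : Fin n, IsHarmonicOn (fun y => G y i j) Ω)
    (hunit : ∀ y ∈ Ω, G y ∈ unitary (Matrix (Fin n) (Fin n) A)) :
    ∀ y ∈ Ω, ∀ y' ∈ Ω, G y = G y' := by
  let : CStarAlgebra A := {}
  intro y hy y' hy'
  ext i j
  refine hΩo.is_const_of_fderiv_eq_zero (𝕜 := ℝ) (f := fun y => G y i j) hΩc.isPreconnected
    ((hharm i j).1.differentiableOn (by norm_num)) (fun z hz => ?_) hy hy'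
  refine fderiv_eq_zero_of_sum_star_mul_self_eq hΩo (f := fun k y => G y k j)
    (fun k => hharm k j) (c := 1) (fun w hw => ?_) hz i
  have h := (hunit w hw).1
  simpa [Matrix.mul_apply, Matrix.star_apply] using congrFun (congrFun h j) j
end

section
/- Let A be a unital C*-algebra, let Ω ⊆ ℝ^N be open and connected, and let g : Ω → A be harmonic on Ω with ‖g(y)‖ ≤ 1 for all y ∈ Ω. If g(y₀) = 1_A for some y₀ ∈ Ω, then g(y) = 1_A for all y ∈ Ω. -/
open Set Filter Topology

theorem deriv_deriv_nonpos_of_isLocalMax {f : ℝ → ℝ} {a : ℝ} (h : IsLocalMax f a)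
    (hc : ContinuousAt f a) : deriv (deriv f) a ≤ 0 := by
  by_contra! hpos
  have hmin := isLocalMin_of_deriv_deriv_pos hpos h.deriv_eq_zero hc
  have hconst : f =ᶠ[𝓝 a] fun _ => f a := by
    filter_upwards [h, hmin] with x h1 h2 using le_antisymm h1 h2
  have := hconst.deriv.deriv_eq
  simp [this] at hpos

section SecondDerivatives

variable {V E : Type*} [NormedAddCommGroup V] [NormedSpace ℝ V] [NormedAddCommGroup E]
  [NormedSpace ℝ E]

theorem ContDiffAt.differentiableAt_fderiv_apply {f : V → E} {p : V} (hf : ContDiffAt ℝ 2 f p)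
    (e : V) : DifferentiableAt ℝ (fun z => fderiv ℝ f z e) p :=
  ((hf.fderiv_right (m := 1) (by norm_num)).differentiableAt (by norm_num)).clm_apply
    (differentiableAt_const e)

theorem ContDiffAt.eventually_differentiableAt {f : V → E} {p : V} (hf : ContDiffAt ℝ 2 f p) :
    ∀ᶠ z in 𝓝 p, DifferentiableAt ℝ f z :=
  (hf.eventually (by simp)).mono fun _ hz => hz.differentiableAt (by norm_num)

theorem ContDiffAt.deriv_deriv_comp_line {f : V → E} {p : V} (hf : ContDiffAt ℝ 2 f p) (e : V) :
    deriv (deriv fun t : ℝ => f (p + t • e)) 0 = fderiv ℝ (fun z => fderiv ℝ f z e) p e := by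
  have hline (t : ℝ) : HasDerivAt (fun t : ℝ => p + t • e) e t := by
    simpa using ((hasDerivAt_id t).smul_const e).const_add p
  have hcont : Tendsto (fun t : ℝ => p + t • e) (𝓝 0) (𝓝 p) := by
    simpa using (hline 0).continuousAt.tendsto
  have h1 : deriv (fun t : ℝ => f (p + t • e)) =ᶠ[𝓝 0] fun t => fderiv ℝ f (p + t • e) e := by
    filter_upwards [hcont.eventually hf.eventually_differentiableAt] with t ht
    exact (ht.hasFDerivAt.comp_hasDerivAt t (hline t)).deriv
  rw [h1.deriv_eq]
  have h2 := (hf.differentiableAt_fderiv_apply e).hasFDerivAt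
  exact (HasFDerivAt.comp_hasDerivAt_of_eq 0 h2 (hline 0) (by simp)).deriv

end SecondDerivatives

section Laplacian

variable {N : ℕ} {E F : Type*} [NormedAddCommGroup E] [NormedSpace ℝ E] [NormedAddCommGroup F]
  [NormedSpace ℝ F]

theorem laplacianAt_add {f g : (Fin N → ℝ) → E} {p : Fin N → ℝ} (hf : ContDiffAt ℝ 2 f p)
    (hg : ContDiffAt ℝ 2 g p) :
    laplacianAt (fun x => f x + g x) p = laplacianAt f p + laplacianAt g p := by
  simp only [laplacianAt, ← Finset.sum_add_distrib]
  refine Finset.sum_congr rfl fun i _ => ?_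
  have h : (fun z => fderiv ℝ (fun x => f x + g x) z (Pi.single i 1)) =ᶠ[𝓝 p]
      fun z => fderiv ℝ f z (Pi.single i 1) + fderiv ℝ g z (Pi.single i 1) := by
    filter_upwards [hf.eventually_differentiableAt, hg.eventually_differentiableAt] with z h1 h2
    rw [fderiv_fun_add h1 h2, add_apply]
  rw [h.fderiv_eq, fderiv_fun_add (hf.differentiableAt_fderiv_apply _)
    (hg.differentiableAt_fderiv_apply _), add_apply]

theorem laplacianAt_clm_comp (L : E →L[ℝ] F) {f : (Fin N → ℝ) → E} {p : Fin N → ℝ}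
    (hf : ContDiffAt ℝ 2 f p) : laplacianAt (fun x => L (f x)) p = L (laplacianAt f p) := by
  simp only [laplacianAt, map_sum]
  refine Finset.sum_congr rfl fun i _ => ?_
  have h : (fun z => fderiv ℝ (fun x => L (f x)) z (Pi.single i 1)) =ᶠ[𝓝 p]
      fun z => L (fderiv ℝ f z (Pi.single i 1)) := by
    filter_upwards [hf.eventually_differentiableAt] with z hz
    exact congrArg (· (Pi.single i 1)) (L.hasFDerivAt.comp z hz.hasFDerivAt).fderiv
  rw [h.fderiv_eq]
  exact congrArg (· (Pi.single i 1)) (L.hasFDerivAt.comp p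
    (hf.differentiableAt_fderiv_apply (Pi.single i 1)).hasFDerivAt).fderiv

theorem laplacianAt_nonpos_of_isLocalMax {f : (Fin N → ℝ) → ℝ} {p : Fin N → ℝ}
    (hf : ContDiffAt ℝ 2 f p) (hmax : IsLocalMax f p) : laplacianAt f p ≤ 0 := by
  refine Finset.sum_nonpos fun i _ => ?_
  rw [← hf.deriv_deriv_comp_line]
  have hc : ContinuousAt (fun t : ℝ => p + t • (Pi.single i 1 : Fin N → ℝ)) 0 := by fun_prop
  refine deriv_deriv_nonpos_of_isLocalMax ?_ ?_
  · have : Tendsto (fun t : ℝ => p + t • (Pi.single i 1 : Fin N → ℝ)) (𝓝 0) (𝓝 p) := by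
      simpa using hc.tendsto
    simpa [IsLocalMax, IsMaxFilter] using this.eventually hmax
  · exact ContinuousAt.comp_of_eq hf.continuousAt hc (by simp)

end Laplacian

/-- The squared Euclidean distance on `Fin N → ℝ`. -/
def sqDist {N : ℕ} (x c : Fin N → ℝ) : ℝ := ∑ i, (x i - c i) ^ 2

section SqDist

variable {N : ℕ} (x c : Fin N → ℝ)

theorem contDiff_sqDist {n : WithTop ℕ∞} : ContDiff ℝ n fun x => sqDist x c := by
  unfold sqDist
  fun_prop

theorem continuous_sqDist_left : Continuous fun x => sqDist x c :=
  (contDiff_sqDist (n := 0) c).continuous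

theorem sqDist_comm : sqDist x c = sqDist c x :=
  Finset.sum_congr rfl fun i _ => by ring

theorem sqDist_self : sqDist x x = 0 := by simp [sqDist]

theorem dist_sq_le_sqDist : dist x c ^ 2 ≤ sqDist x c := by
  have h : dist x c ≤ √(sqDist x c) := by
    rw [dist_pi_le_iff (Real.sqrt_nonneg _)]
    intro i
    rw [Real.dist_eq]
    exact Real.abs_le_sqrt (Finset.single_le_sum (f := fun i => (x i - c i) ^ 2)
      (fun j _ => sq_nonneg _) (Finset.mem_univ i))
  calc dist x c ^ 2 ≤ √(sqDist x c) ^ 2 := by gcongr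
    _ = _ := Real.sq_sqrt (Finset.sum_nonneg fun i _ => sq_nonneg _)

theorem sqDist_pos {x c : Fin N → ℝ} (h : x ≠ c) : 0 < sqDist x c :=
  (pow_pos (dist_pos.2 h) 2).trans_le (dist_sq_le_sqDist x c)

theorem sqDist_add_sqDist (a b : Fin N → ℝ) :
    sqDist x a + sqDist x b =
      2 * sqDist x (midpoint ℝ a b) + 2 * sqDist a (midpoint ℝ a b) := by
  simp only [sqDist, Finset.mul_sum, ← Finset.sum_add_distrib]
  refine Finset.sum_congr rfl fun i _ => ?_
  have : midpoint ℝ a b i = (a i + b i) / 2 := by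
    simp [midpoint_eq_smul_add]; ring
  rw [this]
  ring

theorem sqDist_eq_four_mul (a b : Fin N → ℝ) :
    sqDist a b = 4 * sqDist a (midpoint ℝ a b) := by
  have := sqDist_add_sqDist a a b
  rw [sqDist_self] at this
  linarith

theorem sqDist_add_smul_single (i : Fin N) (t : ℝ) :
    sqDist (x + t • Pi.single i 1) c = sqDist x c + 2 * t * (x i - c i) + t ^ 2 := by
  have h : sqDist (x + t • Pi.single i 1) c - sqDist x c = 2 * t * (x i - c i) + t ^ 2 := by
    rw [sqDist, sqDist, ← Finset.sum_sub_distrib, Finset.sum_eq_single i]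
    · simp; ring
    · intro j _ hj
      simp [hj]
    · simp
  linarith

theorem contDiff_exp_sqDist (ε α : ℝ) {n : WithTop ℕ∞} :
    ContDiff ℝ n fun x => ε * Real.exp (-α * sqDist x c) :=
  contDiff_const.mul (Real.contDiff_exp.comp (contDiff_const.mul (contDiff_sqDist c)))

theorem laplacianAt_exp_sqDist (ε α : ℝ) :
    laplacianAt (fun x => ε * Real.exp (-α * sqDist x c)) x =
      ε * (2 * α * (2 * α * sqDist x c - N) * Real.exp (-α * sqDist x c)) := by
  have key (i : Fin N) : fderiv ℝ (fun z => fderiv ℝ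
      (fun x => ε * Real.exp (-α * sqDist x c)) z (Pi.single i 1)) x (Pi.single i 1) =
      ε * Real.exp (-α * sqDist x c) * (4 * α ^ 2 * (x i - c i) ^ 2 - 2 * α) := by
    rw [← (contDiff_exp_sqDist c ε α).contDiffAt.deriv_deriv_comp_line]
    simp only [sqDist_add_smul_single]
    set b := x i - c i
    set s := sqDist x c
    have hq (t : ℝ) : HasDerivAt (fun t : ℝ => -α * (s + 2 * t * b + t ^ 2))
        (-α * (2 * b + 2 * t)) t := by
      have := (((((hasDerivAt_id t).const_mul 2).mul_const b).const_add s).add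
        (hasDerivAt_pow 2 t)).const_mul (-α)
      exact this.congr_deriv (by norm_num)
    have h1 : deriv (fun t : ℝ => ε * Real.exp (-α * (s + 2 * t * b + t ^ 2))) = fun t =>
        ε * (Real.exp (-α * (s + 2 * t * b + t ^ 2)) * (-α * (2 * b + 2 * t))) :=
      funext fun t => ((hq t).exp.const_mul ε).deriv
    have hl : HasDerivAt (fun t : ℝ => -α * (2 * b + 2 * t)) (-α * 2) 0 := by
      simpa using (((hasDerivAt_id (0 : ℝ)).const_mul 2).const_add (2 * b)).const_mul (-α)
    rw [h1]
    refine (((hq 0).exp.mul hl).const_mul ε).deriv.trans ?_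
    simp
    ring
  simp only [laplacianAt, key]
  rw [← Finset.mul_sum, Finset.sum_sub_distrib, ← Finset.mul_sum, ← sqDist]
  simp
  ring

end SqDist

section MaximumPrinciple

variable {N : ℕ} {Ω : Set (Fin N → ℝ)} {u : (Fin N → ℝ) → ℝ} {M : ℝ}

/-- A Hopf-type lemma: if a Euclidean ball centred at `c` has the interior maximum point `x₀` on its
boundary, then `x₀` cannot be the only maximum point of that closed ball near `x₀`. -/
theorem IsHarmonicOn.not_strict_max_on_ball (hu : IsHarmonicOn u Ω) (hΩ : IsOpen Ω)
    (hle : ∀ x ∈ Ω, u x ≤ M) {x₀ c : Fin N → ℝ} (hx₀ : x₀ ∈ Ω) (hux₀ : u x₀ = M) (hne : x₀ ≠ c)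
    (hlt : ∀ᶠ x in 𝓝 x₀, x ≠ x₀ → sqDist x c ≤ sqDist x₀ c → u x < M) : False := by
  set m := sqDist x₀ c
  have hm : 0 < m := sqDist_pos hne
  have hev : ∀ᶠ x in 𝓝 x₀, x ∈ Ω ∧ m / 2 < sqDist x c ∧
      (x ≠ x₀ → sqDist x c ≤ m → u x < M) :=
    (hΩ.eventually_mem hx₀).and (((continuous_sqDist_left c).continuousAt.eventually
      (lt_mem_nhds (half_lt_self hm))).and hlt)
  obtain ⟨r, hr, hball⟩ := Metric.nhds_basis_closedBall.eventually_iff.1 hev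
  have hu_cont : ContinuousOn u (Metric.closedBall x₀ r) :=
    hu.1.continuousOn.mono fun x hx => (hball hx).1
  let α : ℝ := (N + 1) / m
  have hα : 0 < α := by positivity
  have hK : IsCompact (Metric.sphere x₀ r ∩ {x | sqDist x c ≤ m}) :=
    (isCompact_sphere x₀ r).inter_right
      (isClosed_le (continuous_sqDist_left c) continuous_const)
  obtain ⟨ε, hε, hεu⟩ :
      ∃ ε > 0, ∀ x ∈ Metric.sphere x₀ r ∩ {x | sqDist x c ≤ m}, ε ≤ M - u x := by
    refine hK.exists_forall_le' (continuousOn_const.sub (hu_cont.mono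
      (inter_subset_left.trans Metric.sphere_subset_closedBall))) fun x hx => sub_pos.2 ?_
    exact (hball (Metric.sphere_subset_closedBall hx.1)).2.2
      (Metric.ne_of_mem_sphere hx.1 hr.ne') hx.2
  let w : (Fin N → ℝ) → ℝ := fun x => u x + ε * Real.exp (-α * sqDist x c)
  have hw_sphere : ∀ x ∈ Metric.sphere x₀ r, w x < w x₀ := by
    intro x hx
    change u x + ε * Real.exp (-α * sqDist x c) < u x₀ + ε * Real.exp (-α * m)
    rw [hux₀]
    rcases le_or_gt (sqDist x c) m with h | h
    · have h1 := hεu x ⟨hx, h⟩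
      have hs : 0 < sqDist x c :=
        (half_pos hm).trans (hball (Metric.sphere_subset_closedBall hx)).2.1
      have h2 : Real.exp (-α * sqDist x c) ≤ 1 := Real.exp_le_one_iff.2 (by nlinarith)
      have h3 := mul_le_mul_of_nonneg_left h2 hε.le
      have h4 : 0 < ε * Real.exp (-α * m) := by positivity
      linarith
    · have h1 := hle x (hball (Metric.sphere_subset_closedBall hx)).1
      have h2 : Real.exp (-α * sqDist x c) < Real.exp (-α * m) :=
        Real.exp_lt_exp.2 (by nlinarith)
      have h3 := mul_lt_mul_of_pos_left h2 hε
      linarith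
  have hw_cont : ContinuousOn w (Metric.closedBall x₀ r) :=
    hu_cont.add (contDiff_exp_sqDist (n := 0) c ε α).continuous.continuousOn
  obtain ⟨p, hp, hpmax⟩ := (isCompact_closedBall x₀ r).exists_isMaxOn
    ⟨x₀, Metric.mem_closedBall_self hr.le⟩ hw_cont
  have hp_ball : p ∈ Metric.ball x₀ r := by
    refine lt_of_le_of_ne (Metric.mem_closedBall.1 hp) fun h => ?_
    exact (hw_sphere p h).not_ge (hpmax (Metric.mem_closedBall_self hr.le))
  have hlocal : IsLocalMax w p := hpmax.isLocalMax
    (mem_of_superset (Metric.isOpen_ball.mem_nhds hp_ball) Metric.ball_subset_closedBall)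
  have hpΩ := (hball hp).1
  have hup : ContDiffAt ℝ 2 u p := hu.1.contDiffAt (hΩ.mem_nhds hpΩ)
  have hvp := (contDiff_exp_sqDist c ε α (n := 2)).contDiffAt (x := p)
  have hlap := laplacianAt_nonpos_of_isLocalMax (hup.add hvp) hlocal
  have hsum : laplacianAt w p = _ := laplacianAt_add hup hvp
  rw [hsum, hu.2 p hpΩ, zero_add, laplacianAt_exp_sqDist] at hlap
  have hpos : 0 < 2 * α * sqDist p c - N := by
    have h1 : 2 * α * (m / 2) < 2 * α * sqDist p c := by
      gcongr
      exact (hball hp).2.1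
    have h2 : 2 * α * (m / 2) = N + 1 := by
      simp only [α]
      field_simp
    linarith
  exact hlap.not_gt (by positivity)

theorem IsHarmonicOn.eventually_eq_of_le (hu : IsHarmonicOn u Ω) (hΩ : IsOpen Ω)
    (hle : ∀ x ∈ Ω, u x ≤ M) {x₁ : Fin N → ℝ} (hx₁ : x₁ ∈ Ω) (hux₁ : u x₁ = M) :
    ∀ᶠ x in 𝓝 x₁, u x = M := by
  by_contra hev
  obtain ⟨R, hR, hRΩ⟩ := Metric.nhds_basis_closedBall.mem_iff.1 (hΩ.mem_nhds hx₁)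
  have hnear : ∀ᶠ x in 𝓝 x₁, x ∈ Metric.ball x₁ (R / 2) ∧ sqDist x x₁ < (R / 2) ^ 2 :=
    (Metric.isOpen_ball.eventually_mem (Metric.mem_ball_self (half_pos hR))).and
      ((continuous_sqDist_left x₁).continuousAt.eventually
        (gt_mem_nhds (by simpa [sqDist_self] using pow_pos (half_pos hR) 2)))
  obtain ⟨x₂, hux₂, hx₂, hq₂⟩ := ((not_eventually.1 hev).and_eventually hnear).exists
  have hu_cont : ContinuousOn u (Metric.closedBall x₁ R) := hu.1.continuousOn.mono hRΩ
  have hK : IsCompact (Metric.closedBall x₁ R ∩ u ⁻¹' {M}) :=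
    (isCompact_closedBall x₁ R).of_isClosed_subset
      (hu_cont.preimage_isClosed_of_isClosed Metric.isClosed_closedBall isClosed_singleton)
      inter_subset_left
  have hx₁K : x₁ ∈ Metric.closedBall x₁ R ∩ u ⁻¹' {M} :=
    ⟨Metric.mem_closedBall_self hR.le, hux₁⟩
  obtain ⟨x₀, hx₀, hmin⟩ := hK.exists_isMinOn ⟨x₁, hx₁K⟩
    (continuous_sqDist_left x₂).continuousOn
  have hq₀ : sqDist x₀ x₂ < (R / 2) ^ 2 := by
    rw [sqDist_comm] at hq₂
    exact (hmin hx₁K).trans_lt hq₂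
  have hclose (x : Fin N → ℝ) (hx : sqDist x x₂ < (R / 2) ^ 2) : x ∈ Metric.ball x₁ R := by
    have h1 : dist x x₂ < R / 2 :=
      lt_of_pow_lt_pow_left₀ 2 (half_pos hR).le ((dist_sq_le_sqDist x x₂).trans_lt hx)
    have h2 := dist_triangle x x₂ x₁
    have h3 := Metric.mem_ball.1 hx₂
    rw [Metric.mem_ball]
    linarith
  have hne : x₀ ≠ x₂ := by
    rintro rfl
    exact hux₂ hx₀.2
  -- Shrinking the touching ball to half its radius leaves `x₀` as the only contact point.
  refine hu.not_strict_max_on_ball hΩ hle (hRΩ hx₀.1) hx₀.2 (c := midpoint ℝ x₀ x₂)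
    (fun h => hne ((midpoint_eq_left_iff ℝ).1 h.symm)) (Eventually.of_forall fun x hx hxq => ?_)
  have hlt : sqDist x x₂ < sqDist x₀ x₂ := by
    linarith [sqDist_add_sqDist x x₀ x₂, sqDist_eq_four_mul x₀ x₂, sqDist_pos hx]
  have hxball := Metric.ball_subset_closedBall (hclose x (hlt.trans hq₀))
  exact lt_of_le_of_ne (hle x (hRΩ hxball)) fun h => hlt.not_ge (hmin ⟨hxball, h⟩)

/-- The strong maximum principle for real-valued harmonic functions. -/
theorem IsHarmonicOn.eqOn_of_le (hu : IsHarmonicOn u Ω) (hΩ : IsOpen Ω) (hΩc : IsPreconnected Ω)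
    (hle : ∀ x ∈ Ω, u x ≤ M) {y₀ : Fin N → ℝ} (hy₀ : y₀ ∈ Ω) (huy₀ : u y₀ = M) :
    ∀ y ∈ Ω, u y = M := by
  have hopen : IsOpen {x | x ∈ Ω ∧ u x = M} := isOpen_iff_mem_nhds.2 fun x hx =>
    (hΩ.eventually_mem hx.1).and (hu.eventually_eq_of_le hΩ hle hx.1 hx.2)
  have hopen' : IsOpen {x | x ∈ Ω ∧ u x ≠ M} :=
    hu.1.continuousOn.isOpen_inter_preimage hΩ isOpen_ne
  have hsub := hΩc.subset_left_of_subset_union hopen hopen'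
    (disjoint_left.2 fun x h h' => h'.2 h.2)
    (fun x hx => (em (u x = M)).imp (And.intro hx) (And.intro hx)) ⟨y₀, hy₀, hy₀, huy₀⟩
  exact fun y hy => (hsub hy).2

end MaximumPrinciple

theorem norm_one_add_of_nonneg {A : Type*} [CStarAlgebra A] [PartialOrder A] [StarOrderedRing A]
    [Nontrivial A] {k : A} (hk : 0 ≤ k) : ‖1 + k‖ = 1 + ‖k‖ := by
  refine le_antisymm ((norm_add_le _ _).trans_eq (by rw [norm_one])) ?_
  have h1 : ‖k‖ ∈ spectrum ℝ k := CStarAlgebra.norm_mem_spectrum_of_nonneg hk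
  have h2 : 1 + ‖k‖ ∈ spectrum ℝ (1 + k) := by
    simpa [add_comm] using (spectrum.add_mem_add_iff (s := (1:ℝ)) (a := k) (r := ‖k‖)).2 h1
  have := spectrum.norm_le_norm_of_mem h2
  rwa [Real.norm_of_nonneg (by positivity)] at this

theorem eq_one_of_forall_real_functional {A : Type*} [CStarAlgebra A] {a : A} (ha : ‖a‖ ≤ 1)
    (h : ∀ ψ : A →L[ℝ] ℝ, ψ 1 = 1 → (∀ x, ‖x‖ ≤ 1 → ψ x ≤ 1) → ψ a = 1) : a = 1 := by
  nontriviality A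
  let _ : PartialOrder A := CStarAlgebra.spectralOrder A
  have _ : StarOrderedRing A := CStarAlgebra.spectralOrderedRing A
  let r : A →L[ℝ] A := (1 / 2 : ℝ) • (ContinuousLinearMap.id ℝ A + (starL' ℝ : A ≃L[ℝ] A))
  have hr (x : A) : r x = (1 / 2 : ℝ) • (x + star x) := rfl
  have hr1 : r 1 = 1 := by
    rw [hr, star_one, ← two_smul ℝ (1 : A), smul_smul]
    norm_num
  have hrn (x : A) (hx : ‖x‖ ≤ 1) : ‖r x‖ ≤ 1 := by
    rw [hr, norm_smul]
    have := norm_add_le x (star x)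
    rw [norm_star] at this
    norm_num
    linarith
  have hrs : IsSelfAdjoint (r a) := by
    rw [hr, IsSelfAdjoint, star_smul, star_add, star_star, add_comm, star_trivial]
  have hk : 0 ≤ 1 - r a := by
    rw [sub_nonneg]
    have h1 := hrs.le_algebraMap_norm_self
    refine h1.trans ?_
    rw [← map_one (algebraMap ℝ A)]
    exact algebraMap_mono A (hrn a ha)
  have hra : r a = 1 := by
    have hpos : ‖1 + (1 - r a)‖ ≠ 0 := by
      rw [norm_one_add_of_nonneg hk]
      positivity
    obtain ⟨φ, hφ, hφk⟩ := exists_dual_vector ℂ _ hpos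
    have e := congrArg Complex.re hφk
    rw [norm_one_add_of_nonneg hk, map_add] at e
    have hφr (x : A) : (φ x).re ≤ ‖x‖ :=
      (Complex.re_le_norm _).trans ((φ.le_opNorm x).trans_eq (by rw [hφ, one_mul]))
    have h1 := hφr 1
    have h2 := hφr (1 - r a)
    rw [norm_one] at h1
    simp only [Complex.add_re, Complex.coe_algebraMap, Complex.ofReal_re] at e
    let ψ : A →L[ℝ] ℝ := Complex.reCLM ∘L φ.restrictScalars ℝ ∘L r
    have hψ (x : A) : ψ x = (φ (r x)).re := rfl
    have h3 := h ψ (by rw [hψ, hr1]; linarith)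
      (fun x hx => by rw [hψ]; exact (hφr _).trans (hrn x hx))
    rw [hψ] at h3
    rw [map_sub, Complex.sub_re] at e h2
    have : ‖1 - r a‖ ≤ 0 := by linarith
    exact (sub_eq_zero.1 (norm_le_zero_iff.1 this)).symm
  have hstar : star a = 2 - a := by
    rw [hr] at hra
    have := congrArg (fun x => (2 : ℝ) • x) hra
    simp only [smul_smul] at this
    norm_num [two_smul] at this
    rw [eq_sub_iff_add_eq', this]
  have hd : star a * a = 1 + star (a - 1) * (a - 1) := by
    rw [star_sub, star_one, hstar, ← one_add_one_eq_two]
    noncomm_ring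
  have hd' := congrArg norm hd
  rw [norm_one_add_of_nonneg (star_mul_self_nonneg _), CStarRing.norm_star_mul_self,
    CStarRing.norm_star_mul_self] at hd'
  have : ‖a - 1‖ = 0 := by nlinarith [norm_nonneg a, norm_nonneg (a - 1)]
  exact sub_eq_zero.1 (norm_eq_zero.1 this)

/-- Let `A` be a unital C*-algebra and `g : Ω → A` harmonic on the open
connected set `Ω` with `‖g(y)‖ ≤ 1` everywhere. If `g(y₀) = 1_A` at some `y₀ ∈ Ω`,
then `g ≡ 1_A` on `Ω`. -/
theorem harmonic_cstar_valued_maximum_principle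
    {N : ℕ} {A : Type*} [NormedRing A] [StarRing A] [CStarRing A]
    [NormedAlgebra ℂ A] [StarModule ℂ A] [CompleteSpace A]
    (Ω : Set (Fin N → ℝ)) (hΩo : IsOpen Ω) (hΩc : IsConnected Ω)
    (g : (Fin N → ℝ) → A) (hharm : IsHarmonicOn g Ω)
    (hbdd : ∀ y ∈ Ω, ‖g y‖ ≤ 1)
    (y₀ : Fin N → ℝ) (hy₀ : y₀ ∈ Ω) (hg₀ : g y₀ = 1) :
    ∀ y ∈ Ω, g y = 1 := by
  let _ : CStarAlgebra A := {}
  intro y hy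
  refine eq_one_of_forall_real_functional (hbdd y hy) fun ψ hψ1 hψ => ?_
  refine IsHarmonicOn.eqOn_of_le (u := fun y => ψ (g y)) ?_ hΩo hΩc.isPreconnected
    (fun x hx => hψ _ (hbdd x hx)) hy₀ (by rw [hg₀, hψ1]) y hy
  refine ⟨ψ.contDiff.comp_contDiffOn hharm.1, fun x hx => ?_⟩
  rw [laplacianAt_clm_comp ψ (hharm.1.contDiffAt (hΩo.mem_nhds hx)), hharm.2 x hx, map_zero]
end

section
/- Let Ω ⊆ ℝ^N be open and connected and let Φ : Ω → ℝ^N be a C^∞ map such that every component Φ_i is harmonic on Ω and such that the Jacobian matrix DΦ(y) = (∂Φ_i/∂y_j(y))_{i,j=1}^N is an orthogonal matrix for every y ∈ Ω. Then Φ is affine: there exist an orthogonal matrix A ∈ O(N) and a vector b ∈ ℝ^N such that Φ(y) = Ay + b for all y ∈ Ω. -/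
/-- A linear map on `Fin N → ℝ` vanishing on the standard basis is zero. -/
theorem ContinuousLinearMap.eq_zero_of_apply_single_eq_zero {N : ℕ} (L : (Fin N → ℝ) →L[ℝ] ℝ)
    (h : ∀ k, L (Pi.single k 1) = 0) : L = 0 := by
  ext v
  rw [pi_eq_sum_univ' v, map_sum]
  refine Finset.sum_eq_zero fun k _ => ?_
  simp [h]

/-- A family symmetric in its first two indices and antisymmetric in its last two vanishes. -/
theorem eq_zero_of_symm_of_antisymm {ι : Type*} (T : ι → ι → ι → ℝ)
    (hs : ∀ i j k, T i j k = T j i k) (ha : ∀ i j k, T i j k + T i k j = 0) (i j k : ι) :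
    T i j k = 0 := by
  linarith [hs i j k, hs i k j, hs j k i, ha i j k, ha j i k, ha k i j]

/-- The partial derivatives of a `C²` map whose Jacobian matrix is everywhere orthogonal have
zero derivative. -/
theorem fderiv_partial_eq_zero_of_orthogonal_jacobian {N : ℕ} {Ω : Set (Fin N → ℝ)}
    (hΩo : IsOpen Ω) {Φ : (Fin N → ℝ) → (Fin N → ℝ)} (hΦ : ContDiffOn ℝ 2 Φ Ω)
    (horth : ∀ y ∈ Ω,
      (Matrix.of fun i j : Fin N => fderiv ℝ (fun z => Φ z i) y (Pi.single j 1)) ∈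
        Matrix.orthogonalGroup (Fin N) ℝ) (i j : Fin N) {y : Fin N → ℝ} (hy : y ∈ Ω) :
    fderiv ℝ (fun z => fderiv ℝ (fun w => Φ w i) z (Pi.single j 1)) y = 0 := by
  have hC : ∀ a, ContDiffAt ℝ 2 (fun z => Φ z a) y := fun a =>
    contDiffAt_pi.1 (hΦ.contDiffAt (hΩo.mem_nhds hy)) a
  have hD : ∀ a, DifferentiableAt ℝ (fderiv ℝ (fun z => Φ z a)) y := fun a =>
    ((hC a).fderiv_right (m := 1) (by norm_num)).differentiableAt (by norm_num)
  set P : Fin N → Fin N → (Fin N → ℝ) → ℝ :=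
    fun a b z => fderiv ℝ (fun w => Φ w a) z (Pi.single b 1) with hP
  have hPd : ∀ a b, DifferentiableAt ℝ (P a b) y := fun a b =>
    (hD a).clm_apply (differentiableAt_const _)
  set H : Fin N → Fin N → Fin N → ℝ := fun a b k => fderiv ℝ (P a b) y (Pi.single k 1) with hH
  have hH_eq : ∀ a b k, H a b k =
      fderiv ℝ (fderiv ℝ (fun z => Φ z a)) y (Pi.single k 1) (Pi.single b 1) := by
    intro a b k
    simp only [hH, hP]
    rw [fderiv_clm_apply (hD a) (differentiableAt_const _)]
    simp
  have hsymm : ∀ a b k, H a b k = H a k b := by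
    intro a b k
    rw [hH_eq, hH_eq]
    exact ((hC a).isSymmSndFDerivAt (by simp)).eq _ _
  have hcol : ∀ z ∈ Ω, ∀ b c, ∑ a, P a b z * P a c z = if b = c then 1 else 0 := by
    intro z hz b c
    have h := congrFun (congrFun ((Matrix.mem_orthogonalGroup_iff' (Fin N) ℝ).1 (horth z hz)) b) c
    simpa [Matrix.mul_apply, Matrix.one_apply, Matrix.star_eq_conjTranspose] using h
  have hrow : ∀ b c, ∑ a, P b a y * P c a y = if b = c then 1 else 0 := by
    intro b c
    have h := congrFun (congrFun ((Matrix.mem_orthogonalGroup_iff (Fin N) ℝ).1 (horth y hy)) b) c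
    simpa [Matrix.mul_apply, Matrix.one_apply, Matrix.star_eq_conjTranspose] using h
  have hdiff : ∀ k b c, ∑ a, H a k b * P a c y + ∑ a, H a k c * P a b y = 0 := by
    intro k b c
    have hd := HasFDerivAt.fun_sum (u := Finset.univ) fun a _ =>
      (hPd a b).hasFDerivAt.mul (hPd a c).hasFDerivAt
    have he : (fun z => ∑ a, P a b z * P a c z) =ᶠ[nhds y] fun _ => if b = c then 1 else 0 := by
      filter_upwards [hΩo.mem_nhds hy] with z hz using hcol z hz b c
    have h0 := hd.unique ((hasFDerivAt_const _ y).congr_of_eventuallyEq he)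
    have h1 := congrArg (fun L => L (Pi.single k 1)) h0
    simp only [sum_apply, add_apply,
      smul_apply, smul_eq_mul, zero_apply] at h1
    rw [← Finset.sum_add_distrib, ← h1]
    refine Finset.sum_congr rfl fun a _ => ?_
    rw [hsymm a k b, hsymm a k c]
    simp only [hH]
    ring
  have hT : ∀ k b c, ∑ a, H a k b * P a c y = 0 :=
    eq_zero_of_symm_of_antisymm (fun k b c => ∑ a, H a k b * P a c y)
      (fun k b c => Finset.sum_congr rfl fun a _ => by rw [hsymm a k b]) hdiff
  refine ContinuousLinearMap.eq_zero_of_apply_single_eq_zero _ fun k => ?_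
  change H i j k = 0
  calc H i j k = ∑ a, H a j k * ∑ c, P a c y * P i c y := by simp [hrow]
    _ = ∑ c, (∑ a, H a j k * P a c y) * P i c y := by
      simp only [Finset.mul_sum, Finset.sum_mul]
      rw [Finset.sum_comm]
      simp only [mul_assoc]
    _ = 0 := by simp [hT]

/-- If `Φ : Ω → ℝ^N` is `C^∞` on the open connected set `Ω`, every
component `Φ_i` is harmonic on `Ω` and the Jacobian matrix `DΦ(y)` is orthogonal for
every `y ∈ Ω`, then `Φ` is affine: `Φ(y) = Ay + b` with `A ∈ O(N)` and `b ∈ ℝ^N`. -/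
theorem harmonic_with_orthogonal_jacobian_is_affine
    {N : ℕ} (Ω : Set (Fin N → ℝ)) (hΩo : IsOpen Ω) (hΩc : IsConnected Ω)
    (Φ : (Fin N → ℝ) → (Fin N → ℝ)) (hΦ : ContDiffOn ℝ (⊤ : ℕ∞) Φ Ω)
    (hharm : ∀ i : Fin N, IsHarmonicOn (fun y => Φ y i) Ω)
    (horth : ∀ y ∈ Ω,
      (Matrix.of fun i j : Fin N => fderiv ℝ (fun z => Φ z i) y (Pi.single j 1)) ∈
        Matrix.orthogonalGroup (Fin N) ℝ) :
    ∃ A ∈ Matrix.orthogonalGroup (Fin N) ℝ, ∃ b : Fin N → ℝ,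
      ∀ y ∈ Ω, Φ y = A.mulVec y + b := by
  have hΦ2 : ContDiffOn ℝ 2 Φ Ω := contDiffOn_infty.1 hΦ 2
  obtain ⟨y₀, hy₀⟩ := hΩc.nonempty
  have hpc := hΩc.isPreconnected
  have hC : ∀ a, ∀ y ∈ Ω, ContDiffAt ℝ 2 (fun z => Φ z a) y := fun a y hy =>
    contDiffAt_pi.1 (hΦ2.contDiffAt (hΩo.mem_nhds hy)) a
  have hP : ∀ i j, ∀ y ∈ Ω, fderiv ℝ (fun z => Φ z i) y (Pi.single j 1) =
      fderiv ℝ (fun z => Φ z i) y₀ (Pi.single j 1) := by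
    intro i j y hy
    refine hΩo.is_const_of_fderiv_eq_zero (𝕜 := ℝ)
      (f := fun z => fderiv ℝ (fun w => Φ w i) z (Pi.single j 1)) hpc ?_ ?_ hy hy₀
    · intro z hz
      exact ((((hC i z hz).fderiv_right (m := 1) (by norm_num)).differentiableAt
        (by norm_num)).clm_apply (differentiableAt_const _)).differentiableWithinAt
    · intro z hz
      exact fderiv_partial_eq_zero_of_orthogonal_jacobian hΩo hΦ2 horth i j hz
  set A : Matrix (Fin N) (Fin N) ℝ :=
    Matrix.of fun i j => fderiv ℝ (fun z => Φ z i) y₀ (Pi.single j 1) with hA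
  refine ⟨A, horth y₀ hy₀, Φ y₀ - A.mulVec y₀, fun y hy => ?_⟩
  ext i
  have hL : ∀ v : Fin N → ℝ, A.mulVec v i = fderiv ℝ (fun z => Φ z i) y₀ v := by
    intro v
    conv_rhs => rw [← Finset.univ_sum_single v, map_sum]
    simp only [Matrix.mulVec, dotProduct, hA, Matrix.of_apply]
    refine Finset.sum_congr rfl fun j _ => ?_
    have hj : (Pi.single j (v j) : Fin N → ℝ) = v j • Pi.single j 1 := by
      rw [← Pi.single_smul]
      simp
    rw [hj, map_smul, smul_eq_mul, mul_comm]
  have hd : ∀ z ∈ Ω, HasFDerivAt (fun w => Φ w i - fderiv ℝ (fun z => Φ z i) y₀ w)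
      (fderiv ℝ (fun z => Φ z i) z - fderiv ℝ (fun z => Φ z i) y₀) z := fun z hz =>
    ((hC i z hz).differentiableAt (by norm_num)).hasFDerivAt.sub
      (ContinuousLinearMap.hasFDerivAt _)
  have hconst := hΩo.is_const_of_fderiv_eq_zero (𝕜 := ℝ) hpc
    (fun z hz => (hd z hz).differentiableAt.differentiableWithinAt)
    (fun z hz => by
      rw [(hd z hz).fderiv]
      exact ContinuousLinearMap.eq_zero_of_apply_single_eq_zero _ fun k => by
        simp [hP i k z hz]) hy hy₀
  simp only [Pi.add_apply, Pi.sub_apply, hL]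
  linarith
end
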